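/- arXiv:2409.18363 — 3 statements merged into one kernel-verified Lean document; each statement's English description precedes it below -/
import Mathlib

section
/- Measure increment lemma: Let T be an ergodic measure-preserving ℤ^d-action on a probability space (X, μ), let A ⊆ X be measurable with μ(A) > 0, and let σ be the spectral measure of A. Then for every positive integer M there exist a positive integer k ≤ M! and a T^k-ergodic component ν of μ such that ν(A) ≥ √(μ(A)² + σ(Rat(M))). -/
open MeasureTheory Filter
open scoped symmDiff

/-- A measure-preserving `ℤ^d`-action on `(X, μ)`: a family of measurable maps
`(T v)_{v ∈ ℤ^d}` with `T 0 = id`, `T (v+w) = T v ∘ T w`, each preserving `μ`. -/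
def IsMPAction {X : Type} [MeasurableSpace X] (d : ℕ)
    (T : (Fin d → ℤ) → X → X) (μ : Measure X) : Prop :=
  T 0 = id ∧ (∀ v w, T (v + w) = T v ∘ T w) ∧ ∀ v, MeasurePreserving (T v) μ μ

/-- The action is ergodic: every measurable set invariant (up to null sets) under
all the maps `T v` has measure `0` or `1`. -/
def IsErgodicAction {X : Type} [MeasurableSpace X] (d : ℕ)
    (T : (Fin d → ℤ) → X → X) (μ : Measure X) : Prop :=
  IsMPAction d T μ ∧
    ∀ A : Set X, MeasurableSet A →
      (∀ v, μ ((T v ⁻¹' A) ∆ A) = 0) → μ A = 0 ∨ μ A = 1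

/-- Ergodicity of the restricted `kℤ^d`-action `(T (k•v))_{v ∈ ℤ^d}` with respect to `ν`. -/
def SubActionErgodic {X : Type} [MeasurableSpace X] (d k : ℕ)
    (T : (Fin d → ℤ) → X → X) (ν : Measure X) : Prop :=
  ∀ B : Set X, MeasurableSet B →
    (∀ v : Fin d → ℤ, ν ((T ((k : ℤ) • v) ⁻¹' B) ∆ B) = 0) → ν B = 0 ∨ ν B = 1

/-- A `T^k`-ergodic component of `μ`: a normalized restriction `ν = μ(· ∩ C)/μ(C)` to a
`kℤ^d`-invariant (mod null sets) set `C` of positive measure such that the restricted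
`kℤ^d`-action is ergodic with respect to `ν`. -/
def IsErgodicComponent {X : Type} [MeasurableSpace X] (d k : ℕ)
    (T : (Fin d → ℤ) → X → X) (μ ν : Measure X) : Prop :=
  ∃ C : Set X, MeasurableSet C ∧ 0 < μ C ∧
    (∀ v : Fin d → ℤ, μ ((T ((k : ℤ) • v) ⁻¹' C) ∆ C) = 0) ∧
    ν = (μ C)⁻¹ • μ.restrict C ∧
    SubActionErgodic d k T ν

/-- `σ` is the spectral measure of the set `A`: a finite Borel measure on the torus
`𝕋^d = (ℝ/ℤ)^d` with `μ(A ∩ (T v)⁻¹ A) = ∫ e(v·α) dσ(α)` for all `v ∈ ℤ^d`. -/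
def IsSpectralMeasure {X : Type} [MeasurableSpace X] (d : ℕ)
    (T : (Fin d → ℤ) → X → X) (μ : Measure X) (A : Set X)
    (σ : Measure (Fin d → AddCircle (1 : ℝ))) : Prop :=
  ∀ v : Fin d → ℤ,
    ((μ (A ∩ T v ⁻¹' A)).toReal : ℂ) =
      ∫ α, (AddCircle.toCircle (∑ i, (v i) • (α i)) : ℂ) ∂σ

/-- `Rat(M)`: the set of nonzero torsion points of `𝕋^d` of order at most `M`. -/
def ratTorsion (d M : ℕ) : Set (Fin d → AddCircle (1 : ℝ)) :=
  {α | α ≠ 0 ∧ ∃ q : ℕ, 1 ≤ q ∧ q ≤ M ∧ q • α = 0}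

namespace IsMPAction

variable {X : Type} [MeasurableSpace X] {d : ℕ} {μ : Measure X} {T : (Fin d → ℤ) → X → X}

lemma preimage_preimage (h : IsMPAction d T μ) (v w : Fin d → ℤ) (B : Set X) :
    T w ⁻¹' (T v ⁻¹' B) = T (v + w) ⁻¹' B := by
  rw [h.2.1, Set.preimage_comp]

lemma measurableSet_preimage (h : IsMPAction d T μ) (v : Fin d → ℤ) {B : Set X}
    (hB : MeasurableSet B) : MeasurableSet (T v ⁻¹' B) :=
  (h.2.2 v).measurable hB

lemma measure_preimage (h : IsMPAction d T μ) (v : Fin d → ℤ) {B : Set X}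
    (hB : MeasurableSet B) : μ (T v ⁻¹' B) = μ B :=
  (h.2.2 v).measure_preimage hB.nullMeasurableSet

lemma measure_preimage_inter_preimage (h : IsMPAction d T μ) (v w : Fin d → ℤ) {A : Set X}
    (hA : MeasurableSet A) :
    μ (T v ⁻¹' A ∩ T w ⁻¹' A) = μ (A ∩ T (w - v) ⁻¹' A) := by
  rw [← h.measure_preimage v (hA.inter (h.measurableSet_preimage _ hA)), Set.preimage_inter,
    h.preimage_preimage, sub_add_cancel]

end IsMPAction

section Invariant

variable {X : Type} [MeasurableSpace X] {d : ℕ} {μ : Measure X} {T : (Fin d → ℤ) → X → X}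

/-- The set `C` is invariant modulo null sets under `T (k • v)` for every `v`. -/
def AEInvariant (k : ℕ) (T : (Fin d → ℤ) → X → X) (μ : Measure X) (C : Set X) : Prop :=
  ∀ v : Fin d → ℤ, T ((k : ℤ) • v) ⁻¹' C =ᵐ[μ] C

/-- In an ergodic `ℤ^d`-action every `kℤ^d`-invariant set of positive measure has measure at
least `k⁻ᵈ`. -/
lemma one_le_pow_mul_measure [IsProbabilityMeasure μ] (hT : IsErgodicAction d T μ) {k : ℕ}
    (hk : 0 < k) {C : Set X} (hC : MeasurableSet C) (hinv : AEInvariant k T μ C) (h0 : μ C ≠ 0) :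
    1 ≤ (k ^ d : ℕ) * μ.real C := by
  have hMP := hT.1
  let D : Set X := ⋃ r : Fin d → Fin k, T (fun i => ((r i : ℕ) : ℤ)) ⁻¹' C
  have hD : MeasurableSet D := MeasurableSet.iUnion fun r => hMP.measurableSet_preimage _ hC
  have hle : ∀ w, T w ⁻¹' D ≤ᵐ[μ] D := by
    intro w
    have key : ∀ r : Fin d → Fin k,
        T w ⁻¹' (T (fun i => ((r i : ℕ) : ℤ)) ⁻¹' C) ≤ᵐ[μ] D := by
      intro r
      have hk' : (0 : ℤ) < k := by exact_mod_cast hk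
      let r' : Fin d → Fin k := fun i =>
        ⟨(((r i : ℕ) + w i) % (k : ℤ)).toNat, by
          have h1 := Int.emod_nonneg ((r i : ℕ) + w i) hk'.ne'
          have h2 := Int.emod_lt_of_pos ((r i : ℕ) + w i) hk'
          omega⟩
      let q : Fin d → ℤ := fun i => ((r i : ℕ) + w i) / (k : ℤ)
      have hsum : (fun i => ((r i : ℕ) : ℤ)) + w = (k : ℤ) • q + fun i => ((r' i : ℕ) : ℤ) := by
        ext i
        have h1 := Int.emod_nonneg ((r i : ℕ) + w i) hk'.ne'
        have h2 := Int.mul_ediv_add_emod ((r i : ℕ) + w i) (k : ℤ)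
        simp only [Pi.add_apply, Pi.smul_apply, smul_eq_mul, q, r']
        rw [Int.toNat_of_nonneg h1, h2]
      rw [hMP.preimage_preimage, hsum, ← hMP.preimage_preimage]
      have := (hMP.2.2 (fun i => ((r' i : ℕ) : ℤ))).quasiMeasurePreserving.preimage_ae_eq (hinv q)
      refine this.le.trans ?_
      exact (Set.subset_iUnion (fun r : Fin d → Fin k =>
        T (fun i => ((r i : ℕ) : ℤ)) ⁻¹' C) r').eventuallyLE
    have hall := ae_all_iff.2 key
    filter_upwards [hall] with x hx hxD
    obtain ⟨r, hr⟩ := Set.mem_iUnion.1 (show T w x ∈ D from hxD)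
    exact hx r hr
  have heq : ∀ w, T w ⁻¹' D =ᵐ[μ] D := fun w =>
    ae_eq_of_ae_subset_of_measure_ge (hle w) (hMP.measure_preimage w hD).ge
      (hMP.measurableSet_preimage w hD).nullMeasurableSet (measure_ne_top _ _)
  have hCD : μ C ≤ μ D := by
    have : T (fun _ => (((⟨0, hk⟩ : Fin k) : ℕ) : ℤ)) ⁻¹' C ⊆ D :=
      Set.subset_iUnion (fun r : Fin d → Fin k =>
        T (fun i => ((r i : ℕ) : ℤ)) ⁻¹' C) (fun _ => ⟨0, hk⟩)
    rw [← hMP.measure_preimage _ hC]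
    exact measure_mono this
  have hD1 : μ D = 1 := by
    refine (hT.2 D hD fun v => measure_symmDiff_eq_zero_iff.2 (heq v)).resolve_left ?_
    exact fun h => h0 (nonpos_iff_eq_zero.1 (hCD.trans h.le))
  calc (1 : ℝ) = μ.real D := by simp [measureReal_def, hD1]
    _ ≤ ∑ r : Fin d → Fin k, μ.real (T (fun i => ((r i : ℕ) : ℤ)) ⁻¹' C) :=
        measureReal_iUnion_fintype_le _
    _ = (k ^ d : ℕ) * μ.real C := by
        simp [measureReal_def, hMP.measure_preimage _ hC]

/-- Inside a `kℤ^d`-invariant set on which `A` has density at least `s` there is an ergodic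
component on which `A` has density at least `s`. -/
lemma exists_ergodicComponent_of_density [IsProbabilityMeasure μ] (hT : IsErgodicAction d T μ)
    {k : ℕ} (hk : 0 < k) {A : Set X} (s : ℝ) (n : ℕ) {C : Set X}
    (hC : MeasurableSet C) (hinv : AEInvariant k T μ C) (h0 : μ C ≠ 0)
    (hn : (k ^ d : ℕ) * μ.real C ≤ n) (hs : s * μ.real C ≤ μ.real (A ∩ C)) :
    ∃ ν : Measure X, IsErgodicComponent d k T μ ν ∧ s ≤ (ν A).toReal := by
  induction n generalizing C with
  | zero =>
    have := one_le_pow_mul_measure hT hk hC hinv h0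
    norm_num at hn
    push_cast at this
    linarith
  | succ n ih =>
    by_cases herg : SubActionErgodic d k T ((μ C)⁻¹ • μ.restrict C)
    · refine ⟨_, ⟨C, hC, pos_iff_ne_zero.2 h0,
        fun v => measure_symmDiff_eq_zero_iff.2 (hinv v), rfl, herg⟩, ?_⟩
      have hpos : 0 < μ.real C := ENNReal.toReal_pos h0 (measure_ne_top _ _)
      rw [Measure.smul_apply, Measure.restrict_apply' hC, smul_eq_mul, ENNReal.toReal_mul,
        ENNReal.toReal_inv]
      change s ≤ (μ.real C)⁻¹ * μ.real (A ∩ C)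
      rw [inv_mul_eq_div, le_div_iff₀ hpos]
      exact hs
    · simp only [SubActionErgodic, not_forall, not_or] at herg
      obtain ⟨B, hB, hBinv, hB0, hB1⟩ := herg
      have hnull : ∀ E : Set X, ((μ C)⁻¹ • μ.restrict C) E = 0 ↔ μ (E ∩ C) = 0 := by
        intro E
        rw [Measure.smul_apply, Measure.restrict_apply' hC, smul_eq_mul, mul_eq_zero]
        simp
      have hBC : ∀ v : Fin d → ℤ, ∀ᵐ x ∂μ, x ∈ C → (T ((k : ℤ) • v) x ∈ B ↔ x ∈ B) := by
        intro v
        have h := measure_eq_zero_iff_ae_notMem.1 ((hnull _).1 (hBinv v))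
        filter_upwards [h] with x hx hxC
        simp only [Set.mem_inter_iff, Set.mem_symmDiff, Set.mem_preimage] at hx
        tauto
      have hinv1 : AEInvariant k T μ (C ∩ B) := by
        intro v
        filter_upwards [hBC v, (hinv v).mem_iff] with x hx hxC
        apply propext
        change T _ x ∈ C ∩ B ↔ x ∈ C ∩ B
        simp only [Set.mem_inter_iff, Set.mem_preimage] at *
        tauto
      have hinv2 : AEInvariant k T μ (C \ B) := by
        intro v
        filter_upwards [hBC v, (hinv v).mem_iff] with x hx hxC
        apply propext
        change T _ x ∈ C \ B ↔ x ∈ C \ B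
        simp only [Set.mem_sdiff, Set.mem_preimage] at *
        tauto
      have h01 : μ (C ∩ B) ≠ 0 := by
        rw [Set.inter_comm]
        exact fun h => hB0 ((hnull B).2 h)
      have h02 : μ (C \ B) ≠ 0 := by
        intro h
        apply hB1
        rw [Measure.smul_apply, Measure.restrict_apply' hC, smul_eq_mul, Set.inter_comm]
        have : μ (C ∩ B) = μ C := by
          rw [← measure_inter_add_sdiff C hB, h, add_zero]
        rw [this, ENNReal.inv_mul_cancel h0 (measure_ne_top _ _)]
      have hadd : μ.real (C ∩ B) + μ.real (C \ B) = μ.real C :=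
        measureReal_inter_add_sdiff hB
      have haddA : μ.real (A ∩ (C ∩ B)) + μ.real (A ∩ (C \ B)) = μ.real (A ∩ C) := by
        rw [← measureReal_inter_add_sdiff (s := A ∩ C) hB, Set.inter_assoc, Set.inter_sdiff_assoc]
      have hl1 := one_le_pow_mul_measure hT hk (hC.inter hB) hinv1 h01
      have hl2 := one_le_pow_mul_measure hT hk (hC.diff hB) hinv2 h02
      rw [← hadd] at hn hs
      push_cast at hn hl1 hl2 ih
      by_cases hcase : s * μ.real (C ∩ B) ≤ μ.real (A ∩ (C ∩ B))
      · exact ih (hC.inter hB) hinv1 h01 (by linarith) hcase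
      · exact ih (hC.diff hB) hinv2 h02 (by linarith) (by linarith)

end Invariant

section Spectral

/-- The character `α ↦ exp(2πi v·α)` of the torus. -/
noncomputable def torusChar {d : ℕ} (v : Fin d → ℤ) (α : Fin d → AddCircle (1 : ℝ)) : ℂ :=
  (AddCircle.toCircle (∑ i, (v i) • (α i)) : ℂ)

lemma continuous_torusChar {d : ℕ} (v : Fin d → ℤ) : Continuous (torusChar v) := by
  unfold torusChar
  have := AddCircle.continuous_toCircle (T := (1 : ℝ))
  fun_prop

lemma norm_torusChar {d : ℕ} (v : Fin d → ℤ) (α : Fin d → AddCircle (1 : ℝ)) :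
    ‖torusChar v α‖ = 1 := Circle.norm_coe _

lemma torusChar_eq_prod {d : ℕ} (v : Fin d → ℤ) (α : Fin d → AddCircle (1 : ℝ)) :
    torusChar v α = ∏ i, (AddCircle.toCircle (α i) : ℂ) ^ (v i) := by
  have h : ∀ s : Finset (Fin d), (AddCircle.toCircle (∑ i ∈ s, (v i) • (α i)) : ℂ) =
      ∏ i ∈ s, (AddCircle.toCircle (α i) : ℂ) ^ (v i) := by
    intro s
    induction s using Finset.cons_induction with
    | empty => simp
    | cons a s ha ih =>
      rw [Finset.sum_cons, Finset.prod_cons, AddCircle.toCircle_add, Circle.coe_mul, ih,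
        AddCircle.toCircle_zsmul, Circle.coe_zpow]
  exact h _

lemma torusChar_sub {d : ℕ} (v w : Fin d → ℤ) (α : Fin d → AddCircle (1 : ℝ)) :
    torusChar (w - v) α = torusChar w α * starRingEnd ℂ (torusChar v α) := by
  have : ∑ i, (w - v) i • α i = ∑ i, w i • α i + -∑ i, v i • α i := by
    simp only [Pi.sub_apply, sub_smul, Finset.sum_sub_distrib]
    exact sub_eq_add_neg _ _
  rw [torusChar, this, AddCircle.toCircle_add, AddCircle.toCircle_neg, Circle.coe_mul,
    Circle.coe_inv_eq_conj]
  rfl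

variable {X : Type} [MeasurableSpace X] {d : ℕ} {μ : Measure X} {T : (Fin d → ℤ) → X → X}

/-- The indicator of `(T v)⁻¹ A` as an element of `L²(μ)`. -/
noncomputable def translateIndicator [IsProbabilityMeasure μ] (hMP : IsMPAction d T μ) {A : Set X}
    (hA : MeasurableSet A) (v : Fin d → ℤ) : Lp ℝ 2 μ :=
  indicatorConstLp 2 (hMP.measurableSet_preimage v hA) (measure_ne_top _ _) (1 : ℝ)

/-- The trigonometric polynomial `∑ c i · exp(2πi v_i·α)`. -/
noncomputable def trigPoly {ι : Type*} (s : Finset ι) (c : ι → ℝ) (v : ι → Fin d → ℤ)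
    (α : Fin d → AddCircle (1 : ℝ)) : ℂ :=
  ∑ i ∈ s, (c i : ℂ) * torusChar (v i) α

lemma continuous_trigPoly {ι : Type*} (s : Finset ι) (c : ι → ℝ) (v : ι → Fin d → ℤ) :
    Continuous (trigPoly s c v) :=
  continuous_finsetSum _ fun i _ => continuous_const.mul (continuous_torusChar (v i))

lemma norm_trigPoly_le {ι : Type*} (s : Finset ι) (c : ι → ℝ) (v : ι → Fin d → ℤ)
    (α : Fin d → AddCircle (1 : ℝ)) : ‖trigPoly s c v α‖ ≤ ∑ i ∈ s, |c i| := by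
  refine (norm_sum_le _ _).trans (Finset.sum_le_sum fun i _ => ?_)
  simp [norm_torusChar]

/-- The spectral isometry on finite linear combinations of translates of the indicator of `A`. -/
lemma norm_sq_sum_translateIndicator [IsProbabilityMeasure μ] (hMP : IsMPAction d T μ) {A : Set X}
    (hA : MeasurableSet A) {σ : Measure (Fin d → AddCircle (1 : ℝ))} [IsFiniteMeasure σ]
    (hσ : IsSpectralMeasure d T μ A σ) {ι : Type*} (s : Finset ι) (c : ι → ℝ)
    (v : ι → Fin d → ℤ) :
    ‖∑ i ∈ s, c i • translateIndicator hMP hA (v i)‖ ^ 2 = ∫ α, ‖trigPoly s c v α‖ ^ 2 ∂σ := by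
  have hint : ∀ w : Fin d → ℤ, Integrable (torusChar w) σ := fun w =>
    Integrable.of_bound (continuous_torusChar w).aestronglyMeasurable 1
      (ae_of_all _ fun α => (norm_torusChar w α).le)
  apply Complex.ofReal_injective
  rw [← integral_complex_ofReal]
  have hpt : ∀ α, ((‖trigPoly s c v α‖ ^ 2 : ℝ) : ℂ) =
      ∑ i ∈ s, ∑ j ∈ s, ((c i * c j : ℝ) : ℂ) * torusChar (v j - v i) α := by
    intro α
    rw [Complex.ofReal_pow, ← Complex.mul_conj', mul_comm, trigPoly, map_sum, Finset.sum_mul_sum]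
    refine Finset.sum_congr rfl fun i _ => Finset.sum_congr rfl fun j _ => ?_
    rw [torusChar_sub, map_mul, Complex.conj_ofReal]
    push_cast
    ring
  simp_rw [hpt]
  rw [integral_finsetSum _ fun i _ => integrable_finsetSum _ fun j _ => (hint _).const_mul _]
  simp_rw [integral_finsetSum s fun j _ => (hint (v j - v _)).const_mul _]
  simp_rw [integral_const_mul]
  rw [← real_inner_self_eq_norm_sq, sum_inner]
  simp_rw [inner_sum, real_inner_smul_left, real_inner_smul_right]
  push_cast
  refine Finset.sum_congr rfl fun i _ => Finset.sum_congr rfl fun j _ => ?_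
  rw [translateIndicator, translateIndicator, L2.real_inner_indicatorConstLp_one_indicatorConstLp_one,
    measureReal_def, hMP.measure_preimage_inter_preimage _ _ hA, hσ]
  simp only [torusChar]
  ring

lemma sum_mul_measure_le_norm [IsProbabilityMeasure μ] (hMP : IsMPAction d T μ) {A : Set X}
    (hA : MeasurableSet A) {ι : Type*} (s : Finset ι) (c : ι → ℝ) (v : ι → Fin d → ℤ) :
    (∑ i ∈ s, c i) * μ.real A ≤ ‖∑ i ∈ s, c i • translateIndicator hMP hA (v i)‖ := by
  have h := real_inner_le_norm (indicatorConstLp (μ := μ) 2 MeasurableSet.univ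
    (measure_ne_top _ _) (1 : ℝ)) (∑ i ∈ s, c i • translateIndicator hMP hA (v i))
  rw [norm_indicatorConstLp (by simp) (by simp), inner_sum] at h
  simp only [real_inner_smul_right, translateIndicator,
    L2.real_inner_indicatorConstLp_one_indicatorConstLp_one, Set.univ_inter, measureReal_def,
    hMP.measure_preimage _ hA] at h
  rw [Finset.sum_mul]
  simpa [translateIndicator, measureReal_def] using h

/-- Cesàro averages of the powers of a unimodular number other than `1` tend to `0`. -/
lemma tendsto_average_pow_zero {z : ℂ} (hz : ‖z‖ = 1) (hz1 : z ≠ 1) :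
    Tendsto (fun N : ℕ => (N : ℂ)⁻¹ * ∑ n ∈ Finset.range N, z ^ n) atTop (nhds 0) := by
  have hb : ∀ N : ℕ, ‖∑ n ∈ Finset.range N, z ^ n‖ ≤ 2 / ‖z - 1‖ := by
    intro N
    rw [geom_sum_eq hz1, norm_div]
    gcongr
    refine (norm_sub_le _ _).trans ?_
    rw [norm_pow, hz]
    norm_num
  have h0 : Tendsto (fun N : ℕ => (N : ℝ)⁻¹ * (2 / ‖z - 1‖)) atTop (nhds 0) := by
    simpa using (tendsto_inv_atTop_nhds_zero_nat (𝕜 := ℝ)).mul_const (2 / ‖z - 1‖)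
  refine squeeze_zero_norm (fun N => ?_) h0
  rw [norm_mul, norm_inv, Complex.norm_natCast]
  exact mul_le_mul_of_nonneg_left (hb N) (by positivity)

lemma norm_average_pow_le_one {z : ℂ} (hz : ‖z‖ = 1) (N : ℕ) :
    ‖(N : ℂ)⁻¹ * ∑ n ∈ Finset.range N, z ^ n‖ ≤ 1 := by
  rw [norm_mul, norm_inv, Complex.norm_natCast]
  have : ‖∑ n ∈ Finset.range N, z ^ n‖ ≤ N := by
    refine (norm_sum_le _ _).trans ?_
    simp [hz]
  rw [inv_mul_eq_div]
  exact div_le_one_of_le₀ this (by positivity)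

/-- The average of the characters `v` with `0 ≤ v i < N`. -/
lemma trigPoly_box (N : ℕ) (α : Fin d → AddCircle (1 : ℝ)) :
    trigPoly (Fintype.piFinset fun _ : Fin d => Finset.range N) (fun _ => ((N : ℝ)⁻¹) ^ d)
      (fun x i => (x i : ℤ)) α =
      ∏ i, ((N : ℂ)⁻¹ * ∑ n ∈ Finset.range N, (AddCircle.toCircle (α i) : ℂ) ^ n) := by
  rw [Finset.prod_mul_distrib, Finset.prod_univ_sum, Finset.mul_sum, trigPoly]
  refine Finset.sum_congr rfl fun x _ => ?_
  rw [torusChar_eq_prod]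
  simp

/-- The atom at `0` of the spectral measure of `A` is at least `μ(A)²`. -/
lemma sq_measure_le_spectral_zero [IsProbabilityMeasure μ] (hMP : IsMPAction d T μ) {A : Set X}
    (hA : MeasurableSet A) {σ : Measure (Fin d → AddCircle (1 : ℝ))} [IsFiniteMeasure σ]
    (hσ : IsSpectralMeasure d T μ A σ) : μ.real A ^ 2 ≤ σ.real {0} := by
  let P : ℕ → (Fin d → AddCircle (1 : ℝ)) → ℂ := fun N =>
    trigPoly (Fintype.piFinset fun _ : Fin d => Finset.range N) (fun _ => ((N : ℝ)⁻¹) ^ d)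
      (fun x i => (x i : ℤ))
  have hP1 : ∀ N α, ‖P N α‖ ≤ 1 := by
    intro N α
    simp only [P, trigPoly_box, norm_prod]
    exact Finset.prod_le_one (fun i _ => norm_nonneg _)
      fun i _ => norm_average_pow_le_one (Circle.norm_coe _) N
  have hlim : Tendsto (fun N => ∫ α, ‖P N α‖ ^ 2 ∂σ) atTop
      (nhds (∫ α, Set.indicator {0} (fun _ => (1 : ℝ)) α ∂σ)) := by
    refine tendsto_integral_of_dominated_convergence (fun _ => 1)
      (fun N => ((continuous_trigPoly _ _ _).norm.pow 2).aestronglyMeasurable)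
      (integrable_const _) (fun N => ae_of_all _ fun α => ?_) (ae_of_all _ fun α => ?_)
    · rw [norm_pow, norm_norm]
      exact pow_le_one₀ (norm_nonneg _) (hP1 N α)
    · by_cases hα : α = 0
      · subst hα
        rw [Set.indicator_of_mem (Set.mem_singleton _)]
        refine tendsto_const_nhds.congr' ?_
        filter_upwards [eventually_gt_atTop 0] with N hN
        have : (N : ℂ) ≠ 0 := by exact_mod_cast hN.ne'
        simp only [P, trigPoly_box]
        simp [this]
      · rw [Set.indicator_of_notMem (by simpa using hα)]
        obtain ⟨i, hi⟩ := Function.ne_iff.1 hα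
        have hz : (AddCircle.toCircle (α i) : ℂ) ≠ 1 := by
          intro h
          apply hi
          apply AddCircle.injective_toCircle one_ne_zero
          rw [Pi.zero_apply, AddCircle.toCircle_zero]
          exact Circle.ext (by simpa using h)
        have h1 := (tendsto_average_pow_zero (Circle.norm_coe _) hz).norm
        rw [norm_zero] at h1
        have h2 : Tendsto (fun N => ‖P N α‖) atTop (nhds 0) := by
          refine squeeze_zero (fun _ => norm_nonneg _) (fun N => ?_) h1
          simp only [P, trigPoly_box, norm_prod]
          rw [← Finset.mul_prod_erase _ _ (Finset.mem_univ i)]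
          refine mul_le_of_le_one_right (norm_nonneg _) ?_
          exact Finset.prod_le_one (fun i _ => norm_nonneg _)
            fun i _ => norm_average_pow_le_one (Circle.norm_coe _) N
        simpa using h2.pow 2
  rw [integral_indicator_const _ (measurableSet_singleton _), smul_eq_mul, mul_one] at hlim
  refine ge_of_tendsto hlim ?_
  filter_upwards [eventually_gt_atTop 0] with N hN
  rw [← norm_sq_sum_translateIndicator hMP hA hσ]
  have h := sum_mul_measure_le_norm hMP hA
    (Fintype.piFinset fun _ : Fin d => Finset.range N) (fun _ => ((N : ℝ)⁻¹) ^ d)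
    (fun x i => (x i : ℤ))
  have hN' : (N : ℝ) ≠ 0 := by exact_mod_cast hN.ne'
  have h1 : ∑ x ∈ Fintype.piFinset (fun _ : Fin d => Finset.range N), ((N : ℝ)⁻¹) ^ d = 1 := by
    simp [hN']
  rw [h1, one_mul] at h
  gcongr

/-- A convex combination of the `kℤ^d`-translates of the indicator of `A` has squared norm at
least the spectral mass of the `k`-torsion points. -/
lemma spectral_torsion_le_norm_sq [IsProbabilityMeasure μ] (hMP : IsMPAction d T μ) {A : Set X}
    (hA : MeasurableSet A) {σ : Measure (Fin d → AddCircle (1 : ℝ))} [IsFiniteMeasure σ]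
    (hσ : IsSpectralMeasure d T μ A σ) (k : ℕ) (s : Finset (Fin d → ℤ)) (c : (Fin d → ℤ) → ℝ)
    (hc : ∑ v ∈ s, c v = 1) :
    σ.real {α | k • α = 0} ≤
      ‖∑ v ∈ s, c v • translateIndicator hMP hA ((k : ℤ) • v)‖ ^ 2 := by
  have hmeas : MeasurableSet {α : Fin d → AddCircle (1 : ℝ) | k • α = 0} :=
    (isClosed_eq (by fun_prop) continuous_const).measurableSet
  have hcont := (continuous_trigPoly s c (fun v => (k : ℤ) • v)).norm.pow 2
  rw [norm_sq_sum_translateIndicator hMP hA hσ s c (fun v => (k : ℤ) • v),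
    ← mul_one (σ.real _), ← smul_eq_mul, ← integral_indicator_const _ hmeas]
  refine integral_mono ((integrable_const _).indicator hmeas)
    (Integrable.of_bound hcont.aestronglyMeasurable ((∑ i ∈ s, |c i|) ^ 2)
      (ae_of_all _ fun α => ?_)) fun α => ?_
  · rw [norm_pow, norm_norm]
    gcongr
    exact norm_trigPoly_le _ _ _ _
  · by_cases hα : k • α = 0
    · have h1 : ∀ v : Fin d → ℤ, torusChar ((k : ℤ) • v) α = 1 := by
        intro v
        have : ∑ i, ((k : ℤ) • v) i • α i = 0 := by
          refine Finset.sum_eq_zero fun i _ => ?_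
          have hi : k • α i = 0 := congrFun hα i
          rw [Pi.smul_apply, smul_eq_mul, mul_comm, mul_smul, natCast_zsmul, hi, smul_zero]
        rw [torusChar, this, AddCircle.toCircle_zero, Circle.coe_one]
      rw [Set.indicator_of_mem (by exact hα)]
      simp only [trigPoly, h1, mul_one, ← Complex.ofReal_sum, hc]
      simp
    · rw [Set.indicator_of_notMem (by exact hα)]
      positivity

/-- The average of the indicator of `A` over the `kℤ^d`-action: an invariant element of `L²(μ)`
with nonnegative values whose integral over an invariant set `C` is `μ(A ∩ C)`, and whose squared
norm is at least the spectral mass of the `k`-torsion points. -/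
lemma exists_invariant_average [IsProbabilityMeasure μ] (hMP : IsMPAction d T μ) {A : Set X}
    (hA : MeasurableSet A) {σ : Measure (Fin d → AddCircle (1 : ℝ))} [IsFiniteMeasure σ]
    (hσ : IsSpectralMeasure d T μ A σ) (k : ℕ) :
    ∃ f : Lp ℝ 2 μ, (∀ v : Fin d → ℤ, f ∘ T ((k : ℤ) • v) =ᵐ[μ] f) ∧
      (0 ≤ᵐ[μ] f) ∧
      (∀ C : Set X, MeasurableSet C → AEInvariant k T μ C → ∫ x in C, f x ∂μ = μ.real (A ∩ C)) ∧
      σ.real {α | k • α = 0} ≤ ‖f‖ ^ 2 := by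
  let u : (Fin d → ℤ) → Lp ℝ 2 μ := fun v => translateIndicator hMP hA ((k : ℤ) • v)
  let U : (Fin d → ℤ) → (Lp ℝ 2 μ →ₗᵢ[ℝ] Lp ℝ 2 μ) := fun v =>
    Lp.compMeasurePreservingₗᵢ ℝ (T ((k : ℤ) • v)) (hMP.2.2 _)
  let S : Set (Lp ℝ 2 μ) := convexHull ℝ (Set.range u)
  let K : Set (Lp ℝ 2 μ) := closure S
  have hKconv : Convex ℝ K := (convex_convexHull ℝ _).closure
  have hKne : K.Nonempty := ⟨u 0, subset_closure (subset_convexHull ℝ _ ⟨0, rfl⟩)⟩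
  have hUu : ∀ v w, U w (u v) = u (v + w) := by
    intro v w
    change Lp.compMeasurePreserving _ _ (indicatorConstLp _ _ _ _) = indicatorConstLp _ _ _ _
    rw [Lp.indicatorConstLp_compMeasurePreserving]
    congr 1
    rw [hMP.preimage_preimage, smul_add]
  have hUK : ∀ w, ∀ g ∈ K, U w g ∈ K := by
    intro w
    have hS : Set.MapsTo (U w) S S := by
      refine convexHull_min ?_ ((convex_convexHull ℝ (Set.range u)).linear_preimage
        (U w).toLinearMap)
      rintro _ ⟨v, rfl⟩
      exact subset_convexHull ℝ _ ⟨v + w, (hUu v w).symm⟩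
    exact fun g hg => hS.closure (U w).continuous hg
  obtain ⟨f, hfK, hf⟩ := exists_norm_eq_iInf_of_complete_convex hKne
    isClosed_closure.isComplete hKconv 0
  rw [norm_eq_iInf_iff_real_inner_le_zero hKconv hfK] at hf
  have hUf : ∀ w, U w f = f := by
    intro w
    have h := hf _ (hUK w f hfK)
    rw [zero_sub, inner_neg_left, inner_sub_right, real_inner_self_eq_norm_sq] at h
    have h2 := norm_sub_sq_real f (U w f)
    rw [(U w).norm_map] at h2
    have h3 : ‖f - U w f‖ ^ 2 ≤ 0 := by linarith
    have h4 : ‖f - U w f‖ = 0 := by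
      have := sq_nonneg ‖f - U w f‖
      exact pow_eq_zero_iff (two_ne_zero) |>.1 (le_antisymm h3 this)
    exact (sub_eq_zero.1 (norm_eq_zero.1 h4)).symm
  refine ⟨f, fun v => ?_, ?_, fun C hC hinv => ?_, ?_⟩
  · have h : (U v f : X → ℝ) =ᵐ[μ] f ∘ T ((k : ℤ) • v) := Lp.coeFn_compMeasurePreserving f _
    rw [hUf] at h
    exact h.symm
  · rw [Lp.coeFn_nonneg]
    have hsub : S ⊆ {g | 0 ≤ g} := by
      refine convexHull_min ?_ ?_
      · rintro _ ⟨v, rfl⟩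
        change 0 ≤ u v
        rw [← Lp.coeFn_nonneg]
        filter_upwards [indicatorConstLp_coeFn (p := 2) (μ := μ) (c := (1 : ℝ))
          (hs := hMP.measurableSet_preimage ((k : ℤ) • v) hA) (hμs := measure_ne_top _ _)]
          with x hx
        change (0 : ℝ) ≤ indicatorConstLp 2 _ _ _ x
        rw [hx]
        exact Set.indicator_nonneg (fun _ _ => zero_le_one) _
      · intro g hg h hh a b ha hb _
        change 0 ≤ a • g + b • h
        rw [← Lp.coeFn_nonneg]
        filter_upwards [(Lp.coeFn_nonneg g).2 hg, (Lp.coeFn_nonneg h).2 hh,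
          Lp.coeFn_add (a • g) (b • h), Lp.coeFn_smul a g, Lp.coeFn_smul b h]
          with x h1 h2 h3 h4 h5
        rw [h3, Pi.add_apply, h4, h5]
        exact add_nonneg (mul_nonneg ha h1) (mul_nonneg hb h2)
    exact closure_minimal hsub (isClosed_le continuous_const continuous_id) hfK
  · have hsub : S ⊆ {g | inner ℝ (indicatorConstLp 2 hC (measure_ne_top μ C) (1 : ℝ)) g =
        μ.real (A ∩ C)} := by
      refine convexHull_min ?_ ?_
      · rintro _ ⟨v, rfl⟩
        change inner ℝ _ (indicatorConstLp _ _ _ _) = _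
        rw [L2.real_inner_indicatorConstLp_one_indicatorConstLp_one, measureReal_def,
          measureReal_def, ← hMP.measure_preimage ((k : ℤ) • v) (hA.inter hC), Set.preimage_inter,
          Set.inter_comm]
        congr 1
        exact measure_congr ((ae_eq_refl _).inter (hinv v).symm)
      · intro g hg h hh a b ha hb hab
        simp only [Set.mem_ofPred_eq] at hg hh ⊢
        rw [inner_add_right, real_inner_smul_right, real_inner_smul_right, hg, hh, ← add_mul, hab,
          one_mul]
    have h := closure_minimal hsub (isClosed_eq (by fun_prop) continuous_const) hfK
    rw [← h.out, L2.inner_indicatorConstLp_one]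
  · have hsub : S ⊆ {g | σ.real {α | k • α = 0} ≤ ‖g‖ ^ 2} := by
      intro g hg
      simp only [S] at hg
      rw [convexHull_range_eq_exists_affineCombination] at hg
      obtain ⟨s, c, -, hc, rfl⟩ := hg
      rw [Finset.affineCombination_eq_linear_combination _ _ _ hc]
      exact spectral_torsion_le_norm_sq hMP hA hσ k s c hc
    exact closure_minimal hsub (isClosed_le continuous_const (by fun_prop)) hfK

/-- A nonnegative `L²` function whose squared norm is at least `s²` is not a.e. below `s`. -/
lemma measure_le_ne_zero_of_sq_le_norm_sq [IsProbabilityMeasure μ] (f : Lp ℝ 2 μ)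
    (hf : 0 ≤ᵐ[μ] f) {s : ℝ} (hs : s ^ 2 ≤ ‖f‖ ^ 2) : μ {x | s ≤ f x} ≠ 0 := by
  intro h0
  have hlt : ∀ᵐ x ∂μ, f x < s := by
    filter_upwards [measure_eq_zero_iff_ae_notMem.1 h0] with x hx
    exact not_le.1 hx
  have hint : Integrable (fun x => f x ^ 2) μ := (Lp.memLp f).integrable_sq
  have hnorm : ‖f‖ ^ 2 = ∫ x, f x ^ 2 ∂μ := by
    rw [← real_inner_self_eq_norm_sq, L2.inner_def]
    simp [sq]
  have hnonneg : 0 ≤ᵐ[μ] fun x => s ^ 2 - f x ^ 2 := by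
    filter_upwards [hlt, hf] with x h1 h2
    have h2' : 0 ≤ f x := h2
    change 0 ≤ s ^ 2 - f x ^ 2
    nlinarith
  have hzero : ∫ x, (s ^ 2 - f x ^ 2) ∂μ = 0 := by
    refine le_antisymm ?_ (integral_nonneg_of_ae hnonneg)
    rw [integral_sub (integrable_const _) hint]
    simp
    linarith
  rw [integral_eq_zero_iff_of_nonneg_ae hnonneg ((integrable_const _).sub hint)] at hzero
  have : ∀ᵐ x ∂μ, False := by
    filter_upwards [hlt, hf, hzero] with x h1 h2 h3
    have h2' : 0 ≤ f x := h2
    have h3' : s ^ 2 - f x ^ 2 = 0 := h3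
    nlinarith
  exact this.exists.choose_spec

end Spectral

/-- **Measure increment lemma.** Let `T` be an ergodic measure-preserving `ℤ^d`-action on
a probability space `(X, μ)`, `A` measurable with `μ(A) > 0` and spectral measure `σ`.
Then for every positive integer `M` there are a positive integer `k ≤ M!` and a
`T^k`-ergodic component `ν` of `μ` with `ν(A) ≥ √(μ(A)² + σ(Rat(M)))`. -/
theorem measure_increment
    {X : Type} [MeasurableSpace X] (d : ℕ) (μ : Measure X) [IsProbabilityMeasure μ]
    (T : (Fin d → ℤ) → X → X) (hT : IsErgodicAction d T μ)
    (A : Set X) (hA : MeasurableSet A) (hA0 : 0 < μ A)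
    (σ : Measure (Fin d → AddCircle (1 : ℝ))) [IsFiniteMeasure σ]
    (hσ : IsSpectralMeasure d T μ A σ)
    (M : ℕ) (hM : 0 < M) :
    ∃ k : ℕ, 0 < k ∧ k ≤ M.factorial ∧
      ∃ ν : Measure X, IsErgodicComponent d k T μ ν ∧
        Real.sqrt ((μ A).toReal ^ 2 + (σ (ratTorsion d M)).toReal) ≤ (ν A).toReal := by
  obtain ⟨f, hfinv, hf0, hfint, hfnorm⟩ :=
    exists_invariant_average hT.1 hA hσ M.factorial
  have hk := M.factorial_pos
  set s := Real.sqrt ((μ A).toReal ^ 2 + (σ (ratTorsion d M)).toReal) with hs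
  have hle : s ^ 2 ≤ ‖f‖ ^ 2 := by
    rw [hs, Real.sq_sqrt (by positivity)]
    refine le_trans ?_ hfnorm
    have hdisj : Disjoint (ratTorsion d M) {0} := by
      rw [Set.disjoint_singleton_right]
      exact fun h => h.1 rfl
    have hunion := measureReal_union (μ := σ) hdisj (measurableSet_singleton _)
    have hsub : ratTorsion d M ∪ {0} ⊆ {α | M.factorial • α = 0} := by
      rintro α (⟨-, q, hq1, hqM, hq⟩ | rfl)
      · obtain ⟨m, hm⟩ := Nat.dvd_factorial hq1 hqM
        simp only [Set.mem_ofPred_eq]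
        rw [hm, mul_comm, mul_smul, hq, smul_zero]
      · simp
    have hmono := measureReal_mono (μ := σ) hsub
    have hzero := sq_measure_le_spectral_zero hT.1 hA hσ
    simp only [measureReal_def] at *
    linarith
  have hfm : Measurable f := (Lp.stronglyMeasurable f).measurable
  have hC : MeasurableSet {x | s ≤ f x} := measurableSet_le measurable_const hfm
  have hCinv : AEInvariant M.factorial T μ {x | s ≤ f x} := by
    intro v
    filter_upwards [hfinv v] with x hx
    apply propext
    change s ≤ (f ∘ T _) x ↔ s ≤ f x
    rw [hx]
  refine ⟨M.factorial, hk, le_rfl, exists_ergodicComponent_of_density hT hk s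
    (M.factorial ^ d) hC hCinv (measure_le_ne_zero_of_sq_le_norm_sq f hf0 hle) ?_ ?_⟩
  · exact mul_le_of_le_one_right (by positivity) measureReal_le_one
  · rw [← hfint _ hC hCinv]
    have hfi : Integrable f μ := (Lp.memLp f).integrable one_le_two
    have h := setIntegral_mono_on (integrable_const s).integrableOn hfi.integrableOn hC
      fun x hx => hx
    rwa [setIntegral_const, smul_eq_mul, mul_comm] at h
end

section
/- Existence of a direction whose annihilator has small irrational mass: Let d ≥ 1 and let H be a haystack in ℤ^d. For every real γ > 0 there exists a positive integer M = M(γ, H) such that the following is true: for every finite Borel measure σ on 𝕋^d = (ℝ/ℤ)^d with σ(𝕋^d) ≤ 1 and σ(Rat(M)) ≤ γ/2, there exists a vector v ∈ H_M with σ(L_v^⊥ \ {0}) ≤ γ. -/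
open MeasureTheory Filter
open scoped symmDiff

theorem Matrix.det_zsmul_eq_zero_of_forall_sum_zsmul_eq_zero {n G : Type*} [Fintype n]
    [DecidableEq n] [AddCommGroup G] (A : Matrix n n ℤ) (x : n → G)
    (h : ∀ i, ∑ j, A i j • x j = 0) : A.det • x = 0 := by
  funext k
  have key : ∑ i, A.adjugate k i • ∑ j, A i j • x j = ∑ j, (A.adjugate * A) k j • x j := by
    simp only [Finset.smul_sum, Matrix.mul_apply, Finset.sum_smul, smul_smul]
    exact Finset.sum_comm
  simpa [h, Matrix.adjugate_mul, Matrix.one_apply, ite_smul] using key.symm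

theorem Matrix.det_ne_zero_of_linearIndependent_intCast {n : Type*} [Fintype n] [DecidableEq n]
    (A : Matrix n n ℤ) (h : LinearIndependent ℚ fun i => fun j => (A i j : ℚ)) :
    A.det ≠ 0 := by
  have h1 : IsUnit (A.map (Int.cast : ℤ → ℚ)) :=
    Matrix.linearIndependent_rows_iff_isUnit.mp h
  rw [Matrix.isUnit_iff_isUnit_det, isUnit_iff_ne_zero] at h1
  intro h0
  apply h1
  have := (Int.castRingHom ℚ).map_det A
  rw [h0, map_zero] at this
  exact this.symm

theorem MeasureTheory.sum_measure_le_of_forall_card_le {Ω ι : Type*} [MeasurableSpace Ω]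
    (μ : Measure Ω) (S : Finset ι) (A : ι → Set Ω) (hA : ∀ i ∈ S, MeasurableSet (A i)) (k : ℕ)
    (h : ∀ x, ∀ T ⊆ S, (∀ i ∈ T, x ∈ A i) → T.card ≤ k) :
    ∑ i ∈ S, μ (A i) ≤ k * μ Set.univ := by
  classical
  calc ∑ i ∈ S, μ (A i) = ∑ i ∈ S, ∫⁻ x, (A i).indicator 1 x ∂μ :=
        Finset.sum_congr rfl fun i hi => (lintegral_indicator_one (hA i hi)).symm
    _ = ∫⁻ x, ∑ i ∈ S, (A i).indicator 1 x ∂μ :=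
        (lintegral_finsetSum' _ fun i hi =>
          (measurable_one.indicator (hA i hi)).aemeasurable).symm
    _ ≤ ∫⁻ _, k ∂μ := by
        refine lintegral_mono fun x => ?_
        have h1 := h x (S.filter fun i => x ∈ A i) (Finset.filter_subset _ _)
          fun i hi => (Finset.mem_filter.mp hi).2
        simp only [Set.indicator_apply, Pi.one_apply, Finset.sum_boole]
        exact_mod_cast h1
    _ = k * μ Set.univ := lintegral_const _

theorem measurableSet_ratTorsion (d M : ℕ) : MeasurableSet (ratTorsion d M) := by
  have : ratTorsion d M =
      {0}ᶜ ∩ ⋃ q ∈ Set.Icc 1 M, {α : Fin d → AddCircle (1 : ℝ) | q • α = 0} := by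
    ext α
    simp [ratTorsion, and_assoc]
  rw [this]
  refine (MeasurableSet.singleton 0).compl.inter
    (MeasurableSet.biUnion (Set.to_countable _) fun q _ => ?_)
  exact (isClosed_eq (continuous_const_smul q) continuous_const).measurableSet

theorem measurableSet_annihilator {d : ℕ} (v : Fin d → ℤ) :
    MeasurableSet {α : Fin d → AddCircle (1 : ℝ) | ∑ j, v j • α j = 0} :=
  (isClosed_eq (continuous_finsetSum _ fun j _ => (continuous_apply j).zsmul (v j))
    continuous_const).measurableSet

theorem mem_ratTorsion_of_linearIndependent {d B : ℕ} (w : Fin d → Fin d → ℤ)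
    (hw : LinearIndependent ℚ fun i => fun j => (w i j : ℚ)) (hB : ∀ i j, |w i j| ≤ B)
    {α : Fin d → AddCircle (1 : ℝ)} (hα : α ≠ 0) (h : ∀ i, ∑ j, w i j • α j = 0) :
    α ∈ ratTorsion d (d.factorial * B ^ d) := by
  have hdet : (Matrix.of w).det ≠ 0 := Matrix.det_ne_zero_of_linearIndependent_intCast _ hw
  have hle : |(Matrix.of w).det| ≤ d.factorial * (B : ℤ) ^ d := by
    simpa using Matrix.det_le (A := Matrix.of w) (abv := AbsoluteValue.abs) (x := (B : ℤ)) hB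
  have hzero : (Matrix.of w).det • α = 0 :=
    Matrix.det_zsmul_eq_zero_of_forall_sum_zsmul_eq_zero _ α h
  refine ⟨hα, (Matrix.of w).det.natAbs, Int.natAbs_pos.mpr hdet, ?_, natAbs_nsmul_eq_zero.mpr hzero⟩
  zify
  exact hle

/-- **Existence of a direction whose annihilator has small irrational mass.** Let `H` be a
haystack in `ℤ^d` (an infinite set of primitive vectors, any `d` distinct of which are
linearly independent over `ℚ`). For every `γ > 0` there is a positive integer
`M = M(γ, H)` such that for every finite Borel measure `σ` on `𝕋^d` with `σ(𝕋^d) ≤ 1`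
and `σ(Rat(M)) ≤ γ/2` there is `v ∈ H` with `‖v‖_∞ ≤ (M/d!)^{1/d}` and
`σ(L_v^⊥ \\ {0}) ≤ γ`. -/
theorem exists_direction_with_small_annihilator_mass
    (d : ℕ) (hd : 1 ≤ d) (H : Set (Fin d → ℤ))
    (hInf : H.Infinite)
    (hPrim : ∀ v ∈ H, Finset.univ.gcd v = 1)
    (hIndep : ∀ w : Fin d → (Fin d → ℤ), (∀ i, w i ∈ H) → Function.Injective w →
      LinearIndependent ℚ fun i => fun j => ((w i j : ℚ)))
    (γ : ℝ) (hγ : 0 < γ) :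
    ∃ M : ℕ, 0 < M ∧
      ∀ σ : Measure (Fin d → AddCircle (1 : ℝ)), IsFiniteMeasure σ →
        σ Set.univ ≤ 1 →
        (σ (ratTorsion d M)).toReal ≤ γ / 2 →
        ∃ v ∈ H,
          (∀ j, ((|v j| : ℤ) : ℝ) ≤ ((M : ℝ) / (d.factorial : ℝ)) ^ ((1 : ℝ) / (d : ℝ))) ∧
          (σ ({α : Fin d → AddCircle (1 : ℝ) | ∑ j, (v j) • (α j) = 0} \ {0})).toReal
            ≤ γ := by
  have hd0 : d ≠ 0 := by lia
  obtain ⟨N, hN⟩ := exists_nat_gt (d / (γ / 2))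
  rw [div_lt_iff₀ (half_pos hγ)] at hN
  obtain ⟨S, hSH, hScard⟩ := hInf.exists_subset_card_eq N
  obtain ⟨B, hB0, hB⟩ : ∃ B : ℕ, 0 < B ∧ ∀ v ∈ S, ∀ j, |v j| ≤ B := by
    refine ⟨(∑ v ∈ S, ∑ j, (v j).natAbs) + 1, Nat.succ_pos _, fun v hv j => ?_⟩
    have h1 : (v j).natAbs ≤ ∑ j, (v j).natAbs :=
      Finset.single_le_sum (f := fun j => (v j).natAbs) (fun _ _ => Nat.zero_le _)
        (Finset.mem_univ j)
    have h2 : ∑ j, (v j).natAbs ≤ ∑ v ∈ S, ∑ j, (v j).natAbs :=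
      Finset.single_le_sum (f := fun v : Fin d → ℤ => ∑ j, (v j).natAbs)
        (fun _ _ => Nat.zero_le _) hv
    rw [Int.abs_eq_natAbs]
    exact_mod_cast (h1.trans h2).trans (Nat.le_succ _)
  refine ⟨d.factorial * B ^ d, Nat.mul_pos d.factorial_pos (pow_pos hB0 d), ?_⟩
  intro σ _ hσ hrat
  set R := ratTorsion d (d.factorial * B ^ d)
  let A : (Fin d → ℤ) → Set (Fin d → AddCircle (1 : ℝ)) :=
    fun v => {α | ∑ j, v j • α j = 0} \ {0}
  have hroot : (((d.factorial * B ^ d : ℕ) : ℝ) / d.factorial) ^ ((1 : ℝ) / d) = B := by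
    rw [Nat.cast_mul, mul_div_cancel_left₀ _ (Nat.cast_ne_zero.mpr d.factorial_ne_zero),
      Nat.cast_pow, one_div, Real.pow_rpow_inv_natCast B.cast_nonneg hd0]
  by_contra! hcon
  have hbig : ∀ v ∈ S, γ / 2 ≤ σ.real (A v \ R) := fun v hv => by
    have h1 : γ < σ.real (A v) := hcon v (hSH hv) fun j => by
      rw [hroot]
      exact_mod_cast hB v hv j
    have h2 : σ.real (A v) ≤ σ.real (A v \ R) + σ.real R :=
      (measureReal_mono (by simp)).trans (measureReal_union_le (A v \ R) R)
    have h3 : σ.real R ≤ γ / 2 := hrat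
    linarith
  have hsum : ∑ v ∈ S, σ (A v \ R) ≤ d * σ Set.univ := by
    refine sum_measure_le_of_forall_card_le σ S _ (fun v _ => ((measurableSet_annihilator v).diff
      (MeasurableSet.singleton 0)).diff (measurableSet_ratTorsion _ _)) d fun α T hTS hT => ?_
    by_contra! hcard
    obtain ⟨f⟩ : Nonempty (Fin d ↪ T) :=
      Function.Embedding.nonempty_of_card_le (by simpa using hcard.le)
    refine (hT _ (f ⟨0, hd⟩).2).2 (mem_ratTorsion_of_linearIndependent (fun i => (f i).1)
      (hIndep _ (fun i => hSH (hTS (f i).2)) (Subtype.val_injective.comp f.injective))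
      (fun i => hB _ (hTS (f i).2)) (hT _ (f ⟨0, hd⟩).2).1.2 fun i => (hT _ (f i).2).1.1)
  have hreal : ∑ v ∈ S, σ.real (A v \ R) ≤ d := by
    have h1 : ∑ v ∈ S, σ (A v \ R) ≤ d := hsum.trans (mul_le_of_le_one_right' hσ)
    have h2 := ENNReal.toReal_mono (ENNReal.natCast_ne_top d) h1
    rwa [ENNReal.toReal_sum fun v _ => measure_ne_top σ _, ENNReal.toReal_natCast] at h2
  have hlow : N * (γ / 2) ≤ ∑ v ∈ S, σ.real (A v \ R) := by
    simpa [hScard] using Finset.card_nsmul_le_sum S _ _ hbig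
  linarith
end

section
/- Failure of full polynomial expansivity: For every integer polynomial map P = (P₁, …, P_d) : ℤ → ℤ^d of degree at least 2 (i.e., at least one component P_i has degree ≥ 2), there exist a probability space (X, μ), an ergodic measure-preserving ℤ^d-action T on (X, μ), and a measurable set A ⊆ X with μ(A) > 0 such that for every positive integer k, every T^k-ergodic component ν of μ satisfies ν(⋃_{n∈ℤ} (T^{P(n)})⁻¹A) < 1. -/
open MeasureTheory Filter
open scoped symmDiff

theorem FiniteField.sum_eval_eq_zero_of_natDegree_lt {K : Type*} [Field K] [Fintype K]
    (g : Polynomial K) (hg : g.natDegree < Fintype.card K - 1) : ∑ x, g.eval x = 0 := by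
  simp_rw [Polynomial.eval_eq_sum_range]
  rw [Finset.sum_comm]
  refine Finset.sum_eq_zero fun i hi => ?_
  rw [← Finset.mul_sum, FiniteField.sum_pow_lt_card_sub_one, mul_zero]
  have := Finset.mem_range.1 hi
  omega

/-- A weak form of Wan's theorem: a polynomial that does not permute a finite field misses a
positive proportion of its elements. -/
theorem FiniteField.card_le_mul_card_missed_values {K : Type*} [Field K] [Fintype K]
    [DecidableEq K] (f : Polynomial K) (D : ℕ) (hD : 1 ≤ D) (hf : f.natDegree ≤ D)
    (hinj : ¬ Function.Injective fun x => f.eval x) :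
    Fintype.card K ≤ 2 * D * (Finset.univ.filter fun t => ∀ x, f.eval x ≠ t).card := by
  have hsurj : ¬ Function.Surjective fun x => f.eval x := fun h =>
    hinj (Finite.injective_iff_surjective.2 h)
  obtain ⟨t₀, ht₀⟩ : ∃ t₀, ∀ x, f.eval x ≠ t₀ := by
    simpa [Function.Surjective] using hsurj
  set N : K → ℕ := fun t => (Finset.univ.filter fun x => f.eval x = t).card with hN
  have hN0 : ∀ t, N t = 0 ↔ ∀ x, f.eval x ≠ t := fun t => by
    simp [hN, Finset.filter_eq_empty_iff]
  set S : Finset K := Finset.univ.filter fun t => N t ≠ 1 with hS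
  have hsum : ∑ t, N t = Fintype.card K := by
    rw [← Finset.card_univ]
    exact (Finset.card_eq_sum_card_fiberwise (fun x _ => Finset.mem_univ (f.eval x))).symm
  have hSW : S.card ≤ 2 * (Finset.univ.filter fun t => ∀ x, f.eval x ≠ t).card := by
    have h : ∑ t : K, (1 + if N t ≠ 1 then 1 else 0) ≤
        ∑ t : K, (N t + 2 * if ∀ x, f.eval x ≠ t then 1 else 0) := by
      refine Finset.sum_le_sum fun t _ => ?_
      simp only [← hN0]
      split_ifs <;> omega
    rw [Finset.sum_add_distrib, Finset.sum_add_distrib, hsum, ← Finset.mul_sum,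
      ← Finset.card_filter, ← Finset.card_filter] at h
    simp only [Finset.sum_const, Finset.card_univ, smul_eq_mul, mul_one] at h
    exact Nat.le_of_add_le_add_left h
  have ht₀S : t₀ ∈ S := by simp [hS, (hN0 t₀).2 ht₀]
  set g : Polynomial K := ∏ s ∈ S.erase t₀, (Polynomial.X - Polynomial.C s) with hg
  have hgdeg : g.natDegree = S.card - 1 := by
    rw [hg, Polynomial.natDegree_finsetProd_X_sub_C_eq_card, Finset.card_erase_of_mem ht₀S]
  have hgt₀ : g.eval t₀ ≠ 0 := by
    rw [hg, Polynomial.eval_prod, Finset.prod_ne_zero_iff]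
    intro s hs
    simpa [sub_eq_zero] using (Finset.ne_of_mem_erase hs).symm
  have hkey : ∑ x, g.eval (f.eval x) - ∑ t, g.eval t = - g.eval t₀ := by
    rw [← Finset.sum_fiberwise (g := fun x => f.eval x), ← Finset.sum_sub_distrib,
      Finset.sum_eq_single t₀]
    · have : (Finset.univ.filter fun x => f.eval x = t₀) = ∅ := by
        simpa [Finset.filter_eq_empty_iff] using ht₀
      simp [this]
    · intro t _ ht
      have h1 : ∑ x with f.eval x = t, g.eval (f.eval x) = N t • g.eval t := by
        rw [← Finset.sum_const]
        exact Finset.sum_congr rfl fun x hx => by rw [(Finset.mem_filter.1 hx).2]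
      rw [h1]
      by_cases hNt : N t = 1
      · simp [hNt]
      · have : g.eval t = 0 := by
          rw [hg, Polynomial.eval_prod]
          exact Finset.prod_eq_zero (i := t) (by simp [ht, hS, hNt]) (by simp)
        simp [this]
    · simp
  have hlarge : Fintype.card K - 1 ≤ (S.card - 1) * D := by
    by_contra! hlt
    have h1 : ∑ t, g.eval t = 0 := by
      apply FiniteField.sum_eval_eq_zero_of_natDegree_lt
      rw [hgdeg]
      exact (Nat.le_mul_of_pos_right _ hD).trans_lt hlt
    have h2 : ∑ x, g.eval (f.eval x) = 0 := by
      simp_rw [← Polynomial.eval_comp]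
      apply FiniteField.sum_eval_eq_zero_of_natDegree_lt
      refine lt_of_le_of_lt ?_ hlt
      rw [Polynomial.natDegree_comp, hgdeg]
      exact Nat.mul_le_mul_left _ hf
    rw [h1, h2] at hkey
    exact hgt₀ (by simpa using hkey.symm)
  have hSpos : 1 ≤ S.card := Finset.card_pos.2 ⟨t₀, ht₀S⟩
  obtain ⟨m, hm⟩ := Nat.exists_eq_add_of_le hSpos
  rw [hm] at hlarge hSW
  have : 1 + m - 1 = m := by omega
  rw [this] at hlarge
  have := Nat.mul_le_mul_right D hSW
  nlinarith [Nat.sub_le_iff_le_add.1 hlarge]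

/-- Schur: a nonconstant integer polynomial has prime divisors prime to any given number. -/
theorem Polynomial.exists_prime_dvd_eval_not_dvd (r : Polynomial ℤ) (hr : r.natDegree ≠ 0)
    (N : ℕ) (hN : N ≠ 0) : ∃ p : ℕ, p.Prime ∧ ¬ p ∣ N ∧ ∃ n : ℤ, (p : ℤ) ∣ r.eval n := by
  by_cases hc : r.eval 0 = 0
  · obtain ⟨p, hp, hpp⟩ := Nat.exists_infinite_primes (N + 1)
    exact ⟨p, hpp, fun h => by have := Nat.le_of_dvd (by omega) h; omega, 0, by simp [hc]⟩
  set c := r.eval 0 with hcdef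
  have hne : ∀ b : ℤ, r - C b ≠ 0 := fun b h => hr (by
    rw [sub_eq_zero.1 h, natDegree_C])
  have hfin : {x : ℤ | r.eval x = c ∨ r.eval x = -c}.Finite := by
    refine (Polynomial.finite_setOfPred_isRoot (mul_ne_zero (hne c) (hne (-c)))).subset ?_
    rintro x (h | h) <;> simp [h]
  have hinf : (Set.range fun t : ℤ => c * N * t).Infinite :=
    Set.infinite_range_of_injective
      (mul_right_injective₀ (mul_ne_zero hc (by exact_mod_cast hN)))
  obtain ⟨_, ⟨t, rfl⟩, hx⟩ := hinf.exists_notMem_finite hfin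
  obtain ⟨s, hs⟩ := Polynomial.sub_dvd_eval_sub (c * N * t) 0 r
  have hval : r.eval (c * N * t) = c * (1 + N * t * s) := by
    rw [← hcdef] at hs
    linear_combination hs
  have hu : (1 + N * t * s : ℤ).natAbs ≠ 1 := by
    intro h
    apply hx
    rcases Int.natAbs_eq_iff.1 h with h | h <;> simp [hval, h]
  obtain ⟨p, hp, hpu⟩ := Nat.exists_prime_and_dvd hu
  rw [← Int.natCast_dvd] at hpu
  refine ⟨p, hp, fun hpN => ?_, c * N * t, hval ▸ hpu.mul_left c⟩
  have h1 : (p : ℤ) ∣ N * t * s :=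
    ((Int.natCast_dvd_natCast.2 hpN).mul_right t).mul_right s
  have h2 : (p : ℤ) ∣ 1 := (Int.dvd_add_left h1).1 hpu
  exact hp.one_lt.ne' (Nat.dvd_one.1 (by exact_mod_cast h2))

theorem Polynomial.natDegree_comp_X_add_one_sub_ne_zero (q : Polynomial ℤ)
    (hq : 2 ≤ q.natDegree) : (q.comp (X + 1) - q).natDegree ≠ 0 := by
  intro h
  rw [Polynomial.natDegree_eq_zero] at h
  obtain ⟨c, hc⟩ := h
  have hstep : ∀ n : ℕ, q.eval (n : ℤ) = c * n + q.eval 0 := by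
    intro n
    induction n with
    | zero => simp
    | succ n ih =>
      have := congrArg (Polynomial.eval (n : ℤ)) hc
      simp only [eval_C, eval_sub, eval_comp, eval_add, eval_X, eval_one] at this
      push_cast
      linarith
  have : q = C c * X + C (q.eval 0) := by
    refine Polynomial.eq_of_infinite_eval_eq _ _ ?_
    refine (Set.infinite_range_of_injective (Nat.cast_injective (R := ℤ))).mono ?_
    rintro _ ⟨n, rfl⟩
    simp [hstep n]
  have hle := Polynomial.natDegree_linear_le (a := c) (b := q.eval 0)
  rw [← this] at hle
  omega

/-- The residues modulo `N` of the values of an integer polynomial. -/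
def Polynomial.residues (q : Polynomial ℤ) (N : ℕ) : Set (ZMod N) :=
  Set.range fun n : ℤ => ((q.eval n : ℤ) : ZMod N)

theorem Polynomial.ncard_residues_mul_le (q : Polynomial ℤ) {M N : ℕ} (hM : M ≠ 0) (hN : N ≠ 0)
    (h : M.Coprime N) :
    (q.residues (M * N)).ncard ≤ (q.residues M).ncard * (q.residues N).ncard := by
  have : NeZero M := ⟨hM⟩
  have : NeZero N := ⟨hN⟩
  rw [← Set.ncard_image_of_injective _ (ZMod.chineseRemainder h).injective, ← Set.ncard_prod]
  refine Set.ncard_le_ncard ?_ (Set.toFinite _)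
  rintro _ ⟨_, ⟨n, rfl⟩, rfl⟩
  rw [map_intCast]
  exact ⟨⟨n, by simp⟩, ⟨n, by simp⟩⟩

theorem Polynomial.exists_prime_ncard_residues_le (q : Polynomial ℤ) (hq : 2 ≤ q.natDegree)
    (N : ℕ) (hN : N ≠ 0) : ∃ p : ℕ, p.Prime ∧ ¬ p ∣ N ∧
      ((q.residues p).ncard : ℝ) ≤ (1 - 1 / (2 * q.natDegree)) * p := by
  obtain ⟨p, hp, hpN, n, hn⟩ := Polynomial.exists_prime_dvd_eval_not_dvd _
    (q.natDegree_comp_X_add_one_sub_ne_zero hq) N hN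
  have : Fact p.Prime := ⟨hp⟩
  refine ⟨p, hp, hpN, ?_⟩
  set f := q.map (Int.castRingHom (ZMod p)) with hf
  have heval : ∀ m : ℤ, f.eval (m : ZMod p) = ((q.eval m : ℤ) : ZMod p) := fun m => by
    rw [hf, Polynomial.eval_intCast_map, eq_intCast, Int.cast_id]
  have hinj : ¬ Function.Injective fun x => f.eval x := by
    intro h
    have h1 : f.eval ((n + 1 : ℤ) : ZMod p) = f.eval (n : ZMod p) := by
      rw [heval, heval, ← sub_eq_zero, ← Int.cast_sub, ZMod.intCast_zmod_eq_zero_iff_dvd]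
      simpa using hn
    have := h h1
    simp at this
  have hcard := FiniteField.card_le_mul_card_missed_values f q.natDegree (by omega)
    Polynomial.natDegree_map_le hinj
  rw [ZMod.card] at hcard
  set W := Finset.univ.filter fun t => ∀ x, f.eval x ≠ t with hW
  have hsub : q.residues p ⊆ ((Wᶜ : Finset (ZMod p)) : Set (ZMod p)) := by
    rintro _ ⟨m, rfl⟩
    simp only [hW, Finset.coe_compl, Set.mem_compl_iff, Finset.mem_coe, Finset.mem_filter,
      Finset.mem_univ, true_and, not_forall, not_not]
    exact ⟨m, heval m⟩
  have h1 := Set.ncard_le_ncard hsub (Set.toFinite _)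
  rw [Set.ncard_coe_finset, Finset.card_compl, ZMod.card] at h1
  have h2 : W.card ≤ p := (Finset.card_le_univ W).trans_eq (ZMod.card p)
  have h3 : ((q.residues p).ncard : ℝ) + W.card ≤ p := by
    exact_mod_cast (by omega : (q.residues p).ncard + W.card ≤ p)
  have h4 : (p : ℝ) ≤ 2 * q.natDegree * W.card := by exact_mod_cast hcard
  have hD : (0 : ℝ) < 2 * q.natDegree := by
    have : 0 < q.natDegree := by omega
    positivity
  have h5 : 1 / (2 * (q.natDegree : ℝ)) * p ≤ W.card := by
    rw [one_div_mul_eq_div, div_le_iff₀ hD]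
    linarith
  linarith

theorem Polynomial.exists_ncard_residues_le (q : Polynomial ℤ) (hq : 2 ≤ q.natDegree)
    {ε : ℝ} (hε : 0 < ε) : ∃ N : ℕ, N ≠ 0 ∧ ((q.residues N).ncard : ℝ) ≤ ε * N := by
  set r : ℝ := 1 - 1 / (2 * q.natDegree) with hr
  have hD : (2 : ℝ) ≤ q.natDegree := by exact_mod_cast hq
  have hr1 : r < 1 := by
    have : 0 < 1 / (2 * (q.natDegree : ℝ)) := by positivity
    linarith
  have hr0 : 0 ≤ r := by
    have : 1 / (2 * (q.natDegree : ℝ)) ≤ 1 := by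
      rw [div_le_one (by positivity)]
      linarith
    linarith
  have hpow : ∀ m : ℕ, ∃ N : ℕ, N ≠ 0 ∧ ((q.residues N).ncard : ℝ) ≤ r ^ m * N := by
    intro m
    induction m with
    | zero =>
      refine ⟨1, one_ne_zero, ?_⟩
      have : (q.residues 1).ncard ≤ 1 := Set.ncard_le_one_of_subsingleton _
      simpa using this
    | succ m ih =>
      obtain ⟨N, hN, hNle⟩ := ih
      obtain ⟨p, hp, hpN, hple⟩ := q.exists_prime_ncard_residues_le hq N hN
      refine ⟨N * p, mul_ne_zero hN hp.ne_zero, ?_⟩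
      have hmul : ((q.residues (N * p)).ncard : ℝ) ≤
          (q.residues N).ncard * (q.residues p).ncard := by
        exact_mod_cast q.ncard_residues_mul_le hN hp.ne_zero
          ((Nat.Prime.coprime_iff_not_dvd hp).2 hpN).symm
      calc _ ≤ _ := hmul
        _ ≤ (r ^ m * N) * (r * p) := by gcongr
        _ = r ^ (m + 1) * ((N * p : ℕ) : ℝ) := by push_cast; ring
  obtain ⟨m, hm⟩ := exists_pow_lt_of_lt_one hε hr1
  obtain ⟨N, hN, hle⟩ := hpow m
  exact ⟨N, hN, hle.trans (by gcongr)⟩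

/-- The universal odometer: the closure of the integers in the product of all finite cyclic
groups, that is, the profinite completion of `ℤ`. -/
def universalOdometer : AddSubgroup (∀ n : ℕ, ZMod (n + 1)) :=
  (AddSubgroup.zmultiples 1).topologicalClosure

namespace universalOdometer

instance : CompactSpace universalOdometer :=
  isCompact_iff_compactSpace.1 (AddSubgroup.isClosed_topologicalClosure _).isCompact

instance : SecondCountableTopology universalOdometer :=
  TopologicalSpace.Subtype.secondCountableTopology _

instance : MeasurableSpace universalOdometer := borel _

instance : BorelSpace universalOdometer := ⟨rfl⟩

/-- The generator of the dense copy of `ℤ`. -/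
def gen : universalOdometer :=
  ⟨1, AddSubgroup.le_topologicalClosure _ (AddSubgroup.mem_zmultiples 1)⟩

theorem denseRange_zsmul_gen : DenseRange fun n : ℤ => n • gen := by
  intro x
  rw [closure_subtype]
  have hx : (x : ∀ n : ℕ, ZMod (n + 1)) ∈
      closure (AddSubgroup.zmultiples (1 : ∀ n : ℕ, ZMod (n + 1)) : Set _) := x.2
  refine closure_mono ?_ hx
  rintro _ ⟨n, rfl⟩
  exact ⟨n • gen, ⟨n, rfl⟩, rfl⟩

/-- Reduction modulo `n + 1`. -/
def proj (n : ℕ) : universalOdometer →+ ZMod (n + 1) :=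
  (Pi.evalAddMonoidHom _ n).comp universalOdometer.subtype

theorem proj_gen (n : ℕ) : proj n gen = 1 := rfl

theorem proj_zsmul_gen (n : ℕ) (m : ℤ) : proj n (m • gen) = m := by
  rw [map_zsmul, proj_gen, zsmul_one]

theorem continuous_proj (n : ℕ) : Continuous (proj n) :=
  (continuous_apply n).comp continuous_subtype_val

theorem measurableSet_preimage_proj (n : ℕ) (S : Set (ZMod (n + 1))) :
    MeasurableSet (proj n ⁻¹' S) :=
  ((isOpen_discrete S).preimage (continuous_proj n)).measurableSet

/-- The Haar probability measure. -/
noncomputable def haar : Measure universalOdometer := Measure.addHaarMeasure ⊤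

instance : haar.IsAddHaarMeasure := by unfold haar; infer_instance

instance : haar.Regular := by unfold haar; infer_instance

instance : IsProbabilityMeasure haar :=
  ⟨Measure.addHaarMeasure_self (K₀ := (⊤ : TopologicalSpace.PositiveCompacts universalOdometer))⟩

theorem ergodic_gen_add : Ergodic (gen + ·) haar :=
  ergodic_add_left_of_denseRange_zsmul denseRange_zsmul_gen haar

theorem haar_preimage_proj_singleton (n : ℕ) (c : ZMod (n + 1)) :
    haar (proj n ⁻¹' {c}) = ((n + 1 : ℕ) : ENNReal)⁻¹ := by
  have hc : ∀ c, haar (proj n ⁻¹' {c}) = haar (proj n ⁻¹' {0}) := by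
    intro c
    obtain ⟨m, rfl⟩ := ZMod.intCast_surjective c
    rw [← measure_preimage_add haar (m • gen)]
    congr 1
    ext x
    simp [proj_zsmul_gen]
  have hsum : haar (Set.univ : Set universalOdometer) = ∑ c, haar (proj n ⁻¹' {c}) := by
    rw [← measure_biUnion_finset]
    · congr 1
      ext x
      simp
    · intro b _ c _ hbc
      exact Disjoint.preimage _ (by simpa using hbc)
    · exact fun c _ => measurableSet_preimage_proj n _
  simp only [hc, measure_univ, Finset.sum_const, Finset.card_univ, ZMod.card, nsmul_eq_mul] at hsum
  rw [hc c]
  exact ENNReal.eq_inv_of_mul_eq_one_left (by rw [mul_comm]; exact hsum.symm)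

theorem haar_preimage_proj_le (n : ℕ) (S : Set (ZMod (n + 1))) :
    haar (proj n ⁻¹' S) ≤ S.ncard * ((n + 1 : ℕ) : ENNReal)⁻¹ := by
  classical
  have : proj n ⁻¹' S = ⋃ c ∈ S.toFinset, proj n ⁻¹' {c} := by
    ext x
    simp
  rw [this]
  refine (measure_biUnion_finset_le _ _).trans_eq ?_
  simp [haar_preimage_proj_singleton, Set.ncard_eq_toFinset_card']

end universalOdometer

theorem exists_haar_preimage_residues_add_le (q : Polynomial ℤ) (hq : 2 ≤ q.natDegree) (k : ℕ)
    {ε : NNReal} (hε : 0 < ε) : ∃ N : ℕ, universalOdometer.haar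
      (universalOdometer.proj N ⁻¹' {c | ∃ n : ℤ, ∃ j < k, c = (q.eval n : ℤ) + (j : ℕ)}) ≤ ε := by
  obtain ⟨M, hM, hle⟩ := q.exists_ncard_residues_le hq (ε := ε / (k + 1)) (by positivity)
  obtain ⟨N, rfl⟩ := Nat.exists_eq_succ_of_ne_zero hM
  refine ⟨N, (universalOdometer.haar_preimage_proj_le _ _).trans ?_⟩
  set S : Set (ZMod (N + 1)) := {c | ∃ n : ℤ, ∃ j < k, c = (q.eval n : ℤ) + (j : ℕ)}
  have hS : S.ncard ≤ (q.residues (N + 1)).ncard * k := by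
    have hsub : S ⊆ (fun x : ZMod (N + 1) × ℕ => x.1 + (x.2 : ZMod (N + 1))) ''
        (q.residues (N + 1) ×ˢ Set.Iio k) := by
      rintro _ ⟨n, j, hj, rfl⟩
      exact ⟨(_, j), ⟨⟨n, rfl⟩, hj⟩, rfl⟩
    have hfin : (q.residues (N + 1) ×ˢ Set.Iio k).Finite :=
      (Set.toFinite _).prod (Set.finite_Iio k)
    refine (Set.ncard_le_ncard hsub (hfin.image _)).trans ((Set.ncard_image_le hfin).trans ?_)
    rw [Set.ncard_prod]
    simp
  have hreal : (S.ncard : ℝ) ≤ ε * (N + 1 : ℕ) := by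
    calc (S.ncard : ℝ) ≤ (q.residues (N + 1)).ncard * k := by exact_mod_cast hS
      _ ≤ (ε / (k + 1) * (N + 1 : ℕ)) * (k + 1) := by
        exact mul_le_mul hle (by linarith) (by positivity) (by positivity)
      _ = ε * (N + 1 : ℕ) := by field_simp
  have hnn : (S.ncard : ENNReal) ≤ ε * ((N + 1 : ℕ) : ENNReal) := by
    have : (S.ncard : NNReal) ≤ ε * ((N + 1 : ℕ) : NNReal) := by exact_mod_cast hreal
    exact_mod_cast this
  rw [← div_eq_mul_inv]
  exact ENNReal.div_le_of_le_mul hnn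

/-- For an ergodic map, a set of positive measure almost invariant under the `k`-th iterate
is not disjoint from all of the first `k` preimages of a set of positive measure. -/
theorem Ergodic.exists_measure_inter_preimage_iterate_ne_zero {X : Type*} [MeasurableSpace X]
    {μ : Measure X} [IsFiniteMeasure μ] {f : X → X} (hf : Ergodic f μ) {k : ℕ} (hk : 0 < k)
    {C E : Set X} (hC : MeasurableSet C) (hC0 : μ C ≠ 0) (hE0 : μ E ≠ 0)
    (hinv : f^[k] ⁻¹' C =ᵐ[μ] C) : ∃ j < k, μ (E ∩ f^[j] ⁻¹' C) ≠ 0 := by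
  by_contra! h
  set D : Set X := ⋃ j ∈ Finset.range k, f^[j] ⁻¹' C with hD
  have hDm : MeasurableSet D :=
    Finset.measurableSet_biUnion _ fun j _ => hf.measurable.iterate j hC
  have hle : f ⁻¹' D ≤ᵐ[μ] D := by
    filter_upwards [hinv.mem_iff] with x hx hxD
    change f x ∈ D at hxD
    change x ∈ D
    simp only [hD, Set.mem_iUnion, Finset.mem_range] at hxD ⊢
    obtain ⟨j, hj, hxj⟩ := hxD
    have hx' : x ∈ f^[j + 1] ⁻¹' C := hxj
    rcases (Nat.succ_le_of_lt hj).eq_or_lt with hjk | hjk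
    · refine ⟨0, hk, ?_⟩
      rw [← Nat.succ_eq_add_one, hjk] at hx'
      exact hx.1 hx'
    · exact ⟨j + 1, hjk, hx'⟩
  rcases hf.ae_empty_or_univ_of_preimage_ae_le hDm.nullMeasurableSet hle with h0 | h1
  · refine hC0 (measure_mono_null ?_ (ae_eq_empty.1 h0))
    exact Set.subset_biUnion_of_mem (u := fun j => f^[j] ⁻¹' C)
      (Finset.mem_coe.2 (Finset.mem_range.2 hk))
  · apply hE0
    have hED : μ (E ∩ D) = 0 := by
      simp only [hD, Set.inter_iUnion]
      exact (measure_biUnion_null_iff (Finset.range k).countable_toSet).2 fun j hj =>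
        h j (Finset.mem_range.1 hj)
    rw [← hED]
    refine measure_congr ?_
    filter_upwards [h1.mem_iff] with x hx
    exact propext ⟨fun hE => ⟨hE, hx.2 trivial⟩, And.left⟩

/-- **Failure of full polynomial expansivity.** For every integer polynomial map
`P = (P₁, …, P_d) : ℤ → ℤ^d` of degree at least `2`, there are a probability space
`(X, μ)`, an ergodic measure-preserving `ℤ^d`-action `T` on `(X, μ)` and a measurable
set `A` with `μ(A) > 0` such that for every positive integer `k`, every `T^k`-ergodic
component `ν` of `μ` satisfies `ν(⋃_{n ∈ ℤ} (T^{P(n)})⁻¹ A) < 1`. -/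
theorem failure_of_full_polynomial_expansivity
    (d : ℕ) (p : Fin d → Polynomial ℤ) (hdeg : ∃ i, 2 ≤ (p i).natDegree) :
    ∃ (X : Type) (_ : MeasurableSpace X) (μ : Measure X) (_ : IsProbabilityMeasure μ)
      (T : (Fin d → ℤ) → X → X), IsErgodicAction d T μ ∧
      ∃ A : Set X, MeasurableSet A ∧ 0 < μ A ∧
        ∀ k : ℕ, 0 < k → ∀ ν : Measure X, IsErgodicComponent d k T μ ν →
          ν (⋃ n : ℤ, T (fun i => (p i).eval n) ⁻¹' A) < 1 := by
  obtain ⟨i, hi⟩ := hdeg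
  set q := p i with hq
  obtain ⟨ε, hε, hεsum⟩ := ENNReal.exists_pos_sum_of_countable one_ne_zero ℕ
  choose N hN using fun k => exists_haar_preimage_residues_add_le q hi k (hε k)
  set B : ℕ → Set universalOdometer := fun k =>
    universalOdometer.proj (N k) ⁻¹' {c | ∃ n : ℤ, ∃ j < k, c = (q.eval n : ℤ) + (j : ℕ)} with hB
  have hBm : ∀ k, MeasurableSet (B k) := fun k =>
    universalOdometer.measurableSet_preimage_proj _ _
  set T : (Fin d → ℤ) → universalOdometer → universalOdometer :=
    fun v x => v i • universalOdometer.gen + x with hT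
  have hTm : ∀ v, MeasurePreserving (T v) universalOdometer.haar universalOdometer.haar :=
    fun v => measurePreserving_add_left _ _
  refine ⟨universalOdometer, inferInstance, universalOdometer.haar, inferInstance, T,
    ⟨⟨?_, ?_, hTm⟩, ?_⟩, (⋃ k, B k)ᶜ, (MeasurableSet.iUnion hBm).compl, ?_, ?_⟩
  · ext1 x
    simp [hT]
  · intro v w
    ext1 x
    simp [hT, add_smul, add_assoc]
  · intro A hA hinv
    have h1 := hinv (Pi.single i 1)
    rw [measure_symmDiff_eq_zero_iff] at h1
    have h2 : T (Pi.single i 1) = (universalOdometer.gen + ·) := by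
      ext1 x
      simp [hT]
    rw [h2] at h1
    rcases universalOdometer.ergodic_gen_add.quasiErgodic.ae_empty_or_univ₀
      hA.nullMeasurableSet h1 with h | h
    · exact Or.inl (by rw [measure_congr h, measure_empty])
    · exact Or.inr (by rw [measure_congr h, measure_univ])
  · rw [pos_iff_ne_zero, Ne, prob_compl_eq_zero_iff (MeasurableSet.iUnion hBm)]
    refine ne_of_lt ((measure_iUnion_le _).trans_lt ?_)
    exact (ENNReal.tsum_le_tsum hN).trans_lt hεsum
  · rintro k hk ν ⟨C, hC, hC0, hCinv, rfl, -⟩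
    set U := ⋃ n : ℤ, T (fun i => (p i).eval n) ⁻¹' (⋃ k, B k)ᶜ with hU
    have hUm : MeasurableSet U :=
      MeasurableSet.iUnion fun n =>
        (hTm fun i => (p i).eval n).measurable (MeasurableSet.iUnion hBm).compl
    have hiter : ∀ (j : ℕ) x, (universalOdometer.gen + ·)^[j] x = j • universalOdometer.gen + x :=
      fun j x => by rw [add_left_iterate]
    have hCk : (universalOdometer.gen + ·)^[k] ⁻¹' C =ᵐ[universalOdometer.haar] C := by
      have h1 := hCinv (Pi.single i 1)
      have h2 : T ((k : ℤ) • Pi.single i 1) = (universalOdometer.gen + ·)^[k] := by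
        ext1 x
        simp [hT, hiter]
      rwa [measure_symmDiff_eq_zero_iff, h2] at h1
    obtain ⟨j, hj, hjE⟩ := universalOdometer.ergodic_gen_add
      |>.exists_measure_inter_preimage_iterate_ne_zero hk hC hC0.ne'
        (E := universalOdometer.proj (N k) ⁻¹' {0})
        (by simp [universalOdometer.haar_preimage_proj_singleton]) hCk
    have hsub : universalOdometer.proj (N k) ⁻¹' {0} ∩ (universalOdometer.gen + ·)^[j] ⁻¹' C ⊆
        (universalOdometer.gen + ·)^[j] ⁻¹' (C \ U) := by
      rintro x ⟨hx0, hxC⟩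
      refine ⟨hxC, fun hxU => ?_⟩
      obtain ⟨n, hn⟩ := Set.mem_iUnion.1 hxU
      refine hn (Set.mem_iUnion.2 ⟨k, n, j, hj, ?_⟩)
      have hx0' : universalOdometer.proj (N k) x = 0 := hx0
      simp [hT, hiter, hx0', universalOdometer.proj_gen, hq]
    have hpos : universalOdometer.haar (C \ U) ≠ 0 := by
      intro h0
      refine hjE (measure_mono_null hsub ?_)
      rwa [(universalOdometer.ergodic_gen_add.toMeasurePreserving.iterate j).measure_preimage
        (hC.diff hUm).nullMeasurableSet]
    rw [Measure.smul_apply, Measure.restrict_apply hUm, smul_eq_mul, mul_comm, ← div_eq_mul_inv,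
      ENNReal.div_lt_iff (Or.inl hC0.ne') (Or.inl (measure_ne_top _ _)), one_mul, Set.inter_comm]
    calc universalOdometer.haar (C ∩ U)
        < universalOdometer.haar (C ∩ U) + universalOdometer.haar (C \ U) :=
          ENNReal.lt_add_right (measure_ne_top _ _) hpos
      _ = universalOdometer.haar C := measure_inter_add_sdiff C hUm
end
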